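/- Let d = 2 and γ ∈ (0, 1). There exists a constant C > 0 such that for all N ≥ 1, every l ∈ ℤ²₀, and every unit vector a ∈ ℝ² orthogonal to l, one has |∑_{k ∈ ℤ²₀, k ≠ l} (θ^N_k)² sin²(∠_{k,l}) (a·(k−l))²/|k−l|² − 3/8| ≤ C D_N |l|. -/

import Mathlib

/-- Euclidean norm of a lattice point `k ∈ ℤ^d`. -/
noncomputable def znorm {d : ℕ} (k : Fin d → ℤ) : ℝ :=
  Real.sqrt (∑ i, ((k i : ℝ)) ^ 2)

/-- Euclidean inner product of two lattice points. -/
noncomputable def zdot {d : ℕ} (k l : Fin d → ℤ) : ℝ :=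
  ∑ i, (k i : ℝ) * (l i : ℝ)

/-- Inner product of a real vector with a lattice point. -/
noncomputable def rdot {d : ℕ} (a : Fin d → ℝ) (k : Fin d → ℤ) : ℝ :=
  ∑ i, a i * (k i : ℝ)

/-- `sin²(∠_{k,l}) = 1 - (k·l)²/(|k|²|l|²)`. -/
noncomputable def sin2 {d : ℕ} (k l : Fin d → ℤ) : ℝ :=
  1 - zdot k l ^ 2 / (znorm k ^ 2 * znorm l ^ 2)

/-- `ε_N = (∑_{k ∈ ℤ^d₀, |k| ≤ N} |k|^{-2γ})⁻¹`. -/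
noncomputable def epsN (d : ℕ) (γ : ℝ) (N : ℕ) : ℝ :=
  (∑' k : Fin d → ℤ, if k ≠ 0 ∧ znorm k ≤ N then znorm k ^ (-(2 : ℝ) * γ) else 0)⁻¹

/-- `θ^N_k = √ε_N |k|^{-γ} 1_{1 ≤ |k| ≤ N}`. -/
noncomputable def thetaN (d : ℕ) (γ : ℝ) (N : ℕ) (k : Fin d → ℤ) : ℝ :=
  if 1 ≤ znorm k ∧ znorm k ≤ N then Real.sqrt (epsN d γ N) * znorm k ^ (-γ) else 0

/-- `D_N = ε_N ∑_{k ∈ ℤ^d₀, |k| ≤ N} |k|^{-2γ-1}`. -/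
noncomputable def DN (d : ℕ) (γ : ℝ) (N : ℕ) : ℝ :=
  epsN d γ N *
    ∑' k : Fin d → ℤ, if k ≠ 0 ∧ znorm k ≤ N then znorm k ^ (-(2 : ℝ) * γ - 1) else 0

/-- A lattice point of `ℤ²` seen as a Gaussian integer in `ℂ`. -/
noncomputable def toC (k : Fin 2 → ℤ) : ℂ := (k 0 : ℂ) + (k 1 : ℂ) * Complex.I

/-- The radial weight `|k|^s` truncated to `0 < |k| ≤ N`. -/
noncomputable def wt (s : ℝ) (N : ℕ) (k : Fin 2 → ℤ) : ℝ :=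
  if k ≠ 0 ∧ znorm k ≤ N then znorm k ^ s else 0

lemma toC_re (k : Fin 2 → ℤ) : (toC k).re = k 0 := by simp [toC]

lemma toC_im (k : Fin 2 → ℤ) : (toC k).im = k 1 := by simp [toC]

lemma znorm_sq (k : Fin 2 → ℤ) : znorm k ^ 2 = (k 0 : ℝ) ^ 2 + (k 1 : ℝ) ^ 2 := by
  rw [znorm, Real.sq_sqrt (Finset.sum_nonneg fun i _ => sq_nonneg _), Fin.sum_univ_two]

lemma znorm_nonneg (k : Fin 2 → ℤ) : 0 ≤ znorm k := Real.sqrt_nonneg _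

lemma norm_toC (k : Fin 2 → ℤ) : ‖toC k‖ = znorm k := by
  rw [← sq_eq_sq₀ (norm_nonneg _) (znorm_nonneg _), znorm_sq, Complex.sq_norm,
    Complex.normSq_apply, toC_re, toC_im]
  ring

lemma one_le_znorm {k : Fin 2 → ℤ} (hk : k ≠ 0) : 1 ≤ znorm k := by
  have h : (1 : ℤ) ≤ k 0 ^ 2 + k 1 ^ 2 := by
    by_contra! h
    have h0 : k 0 = 0 := by nlinarith [sq_nonneg (k 0), sq_nonneg (k 1)]
    have h1 : k 1 = 0 := by nlinarith [sq_nonneg (k 0), sq_nonneg (k 1)]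
    exact hk (by ext i; fin_cases i <;> simp [h0, h1])
  have h' : (1 : ℝ) ≤ znorm k ^ 2 := by rw [znorm_sq]; exact_mod_cast h
  nlinarith [znorm_nonneg k]

lemma one_le_znorm_iff {k : Fin 2 → ℤ} : 1 ≤ znorm k ↔ k ≠ 0 := by
  refine ⟨?_, one_le_znorm⟩
  rintro h rfl
  simp [znorm] at h
  linarith

lemma wt_nonneg (s : ℝ) (N : ℕ) (k : Fin 2 → ℤ) : 0 ≤ wt s N k := by
  unfold wt
  split_ifs
  · exact Real.rpow_nonneg (znorm_nonneg k) s
  · exact le_rfl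

lemma finite_ball (N : ℕ) : {k : Fin 2 → ℤ | znorm k ≤ N}.Finite := by
  refine (Set.finite_Icc (fun _ => -(N : ℤ)) (fun _ => (N : ℤ))).subset fun k hk => ?_
  have hk : znorm k ≤ N := hk
  have h : (k 0 : ℝ) ^ 2 + (k 1 : ℝ) ^ 2 ≤ (N : ℝ) ^ 2 := by
    rw [← znorm_sq]; exact pow_le_pow_left₀ (znorm_nonneg k) hk 2
  have h' : k 0 ^ 2 + k 1 ^ 2 ≤ (N : ℤ) ^ 2 := by exact_mod_cast h
  have h0 := abs_le_of_sq_le_sq' (show k 0 ^ 2 ≤ (N : ℤ) ^ 2 by nlinarith [sq_nonneg (k 1)])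
    (by positivity)
  have h1 := abs_le_of_sq_le_sq' (show k 1 ^ 2 ≤ (N : ℤ) ^ 2 by nlinarith [sq_nonneg (k 0)])
    (by positivity)
  constructor <;> intro i <;> fin_cases i <;> simp [h0, h1]

lemma support_wt_finite (s : ℝ) (N : ℕ) : (Function.support (wt s N)).Finite := by
  refine (finite_ball N).subset fun k hk => ?_
  by_contra h
  exact hk (by simp only [wt]; rw [if_neg fun h' => h h'.2])

lemma summable_wt_mul (s : ℝ) (N : ℕ) (g : (Fin 2 → ℤ) → ℝ) :
    Summable fun k => wt s N k * g k := by
  refine summable_of_hasFiniteSupport ((support_wt_finite s N).subset fun k hk => ?_)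
  exact fun h => hk (by simp [h])

lemma summable_wt (s : ℝ) (N : ℕ) : Summable (wt s N) :=
  summable_of_hasFiniteSupport (support_wt_finite s N)

lemma summable_wt_mul_complex (s : ℝ) (N : ℕ) (g : (Fin 2 → ℤ) → ℂ) :
    Summable fun k => (wt s N k : ℂ) * g k := by
  refine summable_of_hasFiniteSupport ((support_wt_finite s N).subset fun k hk => ?_)
  exact fun h => hk (by simp [h])

lemma tsum_wt_pos {s : ℝ} {N : ℕ} (hN : 1 ≤ N) : 0 < ∑' k, wt s N k := by
  have h1 : znorm (![1, 0] : Fin 2 → ℤ) = 1 := by simp [znorm]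
  refine (summable_wt s N).tsum_pos (wt_nonneg s N) ![1, 0] ?_
  have h2 : (![1, 0] : Fin 2 → ℤ) ≠ 0 := fun h => by simpa using congrFun h 0
  have h3 : (1 : ℝ) ≤ N := by exact_mod_cast hN
  simp [wt, h1, h2, h3]

/-- Quarter-turn of the lattice. -/
def quarterTurn : (Fin 2 → ℤ) ≃ (Fin 2 → ℤ) where
  toFun k := ![-k 1, k 0]
  invFun k := ![k 1, -k 0]
  left_inv k := by ext i; fin_cases i <;> simp
  right_inv k := by ext i; fin_cases i <;> simp

lemma toC_quarterTurn (k : Fin 2 → ℤ) : toC (quarterTurn k) = Complex.I * toC k := by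
  apply Complex.ext <;> simp [toC, quarterTurn]

lemma znorm_quarterTurn (k : Fin 2 → ℤ) : znorm (quarterTurn k) = znorm k := by
  rw [← norm_toC, ← norm_toC, toC_quarterTurn]; simp

lemma toC_eq_zero {k : Fin 2 → ℤ} : toC k = 0 ↔ k = 0 := by
  refine ⟨fun h => ?_, fun h => by simp [h, toC]⟩
  by_contra hk
  have := one_le_znorm hk
  rw [← norm_toC, h, norm_zero] at this
  linarith

lemma wt_quarterTurn (s : ℝ) (N : ℕ) (k : Fin 2 → ℤ) : wt s N (quarterTurn k) = wt s N k := by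
  have h : quarterTurn k = 0 ↔ k = 0 := by
    rw [← toC_eq_zero, toC_quarterTurn, ← toC_eq_zero]; simp
  simp only [wt, znorm_quarterTurn, ne_eq, h]

/-- The second angular harmonic averages to zero against radial weights. -/
lemma tsum_second_harmonic (s : ℝ) (N : ℕ) (c : ℂ) :
    ∑' k, wt s N k * ((c * toC k ^ 2).re / (2 * znorm k ^ 2)) = 0 := by
  have h := quarterTurn.tsum_eq fun k => wt s N k * ((c * toC k ^ 2).re / (2 * znorm k ^ 2))
  have h2 : ∀ k, wt s N (quarterTurn k) *
      ((c * toC (quarterTurn k) ^ 2).re / (2 * znorm (quarterTurn k) ^ 2)) =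
      -(wt s N k * ((c * toC k ^ 2).re / (2 * znorm k ^ 2))) := by
    intro k
    rw [wt_quarterTurn, znorm_quarterTurn, toC_quarterTurn, mul_pow, Complex.I_sq]
    simp only [neg_mul, one_mul, mul_neg, Complex.neg_re]
    ring
  simp only [h2, tsum_neg] at h
  linarith

/-- A lattice bijection `σ` for which `(2 + i) k` and `(2 - i) σ(k)` stay within distance `8`. -/
def coincidence : (Fin 2 → ℤ) ≃ (Fin 2 → ℤ) where
  toFun k := ![k 0 - 2 * ((k 0 + 2 * k 1) / 5), 4 * ((k 0 + 2 * k 1) / 5) - k 1]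
  invFun k := ![k 0 - 2 * ((k 0 - 2 * k 1) / 5), -(4 * ((k 0 - 2 * k 1) / 5) + k 1)]
  left_inv k := by
    ext i; fin_cases i <;> simp <;> omega
  right_inv k := by
    ext i; fin_cases i <;> simp <;> omega

lemma norm_sub_coincidence_le (k : Fin 2 → ℤ) :
    ‖(2 + Complex.I) * toC k - (2 - Complex.I) * toC (coincidence k)‖ ≤ 8 := by
  have h : (2 + Complex.I) * toC k - (2 - Complex.I) * toC (coincidence k) =
      ((2 * ((k 0 + 2 * k 1) % 5) : ℤ) : ℂ) * Complex.I := by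
    have h5 : (k 0 + 2 * k 1) % 5 = k 0 + 2 * k 1 - 5 * ((k 0 + 2 * k 1) / 5) := by omega
    rw [h5]
    apply Complex.ext <;> simp [toC, coincidence] <;> ring
  rw [h, norm_mul, Complex.norm_I, mul_one, Complex.norm_intCast, ← Int.cast_abs]
  have : |2 * ((k 0 + 2 * k 1) % 5)| ≤ 8 := by
    rw [abs_le]; omega
  exact_mod_cast this

lemma coincidence_eq_zero {k : Fin 2 → ℤ} : coincidence k = 0 ↔ k = 0 := by
  have h : coincidence 0 = 0 := by ext i; fin_cases i <;> simp [coincidence]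
  rw [← coincidence.apply_eq_iff_eq (x := k) (y := 0), h]

lemma norm_two_add_I : ‖(2 + Complex.I : ℂ)‖ = √5 := by
  rw [Complex.norm_def]; congr 1; simp [Complex.normSq_apply]; norm_num

lemma norm_two_sub_I : ‖(2 - Complex.I : ℂ)‖ = √5 := by
  rw [Complex.norm_def]; congr 1; simp [Complex.normSq_apply]; norm_num

lemma two_le_sqrt_five : (2 : ℝ) ≤ √5 := Real.le_sqrt_of_sq_le (by norm_num)

lemma abs_znorm_sub_coincidence_le (k : Fin 2 → ℤ) :
    |znorm k - znorm (coincidence k)| ≤ 4 := by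
  have h := (abs_norm_sub_norm_le _ _).trans (norm_sub_coincidence_le k)
  rw [norm_mul, norm_mul, norm_two_add_I, norm_two_sub_I, norm_toC, norm_toC, ← mul_sub,
    abs_mul, abs_of_nonneg (Real.sqrt_nonneg 5)] at h
  nlinarith [two_le_sqrt_five, abs_nonneg (znorm k - znorm (coincidence k))]

lemma norm_div_norm_sub_le {p q : ℂ} (hp : p ≠ 0) (hq : q ≠ 0) :
    ‖p / ‖p‖ - q / ‖q‖‖ ≤ 2 * ‖p - q‖ / ‖p‖ := by
  have hp' : (0 : ℝ) < ‖p‖ := norm_pos_iff.2 hp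
  have hq' : (0 : ℝ) < ‖q‖ := norm_pos_iff.2 hq
  have hpc : (‖p‖ : ℂ) ≠ 0 := by exact_mod_cast hp'.ne'
  have hqc : (‖q‖ : ℂ) ≠ 0 := by exact_mod_cast hq'.ne'
  have h : p / ‖p‖ - q / ‖q‖ = ((p - q) + (q / ‖q‖) * ((‖q‖ - ‖p‖ : ℝ) : ℂ)) / ‖p‖ := by
    push_cast; field_simp; ring
  rw [h, norm_div, Complex.norm_real, norm_norm]
  gcongr
  refine (norm_add_le _ _).trans ?_
  rw [norm_mul, norm_div, Complex.norm_real, Complex.norm_real, norm_norm, div_self hq'.ne',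
    one_mul, Real.norm_eq_abs]
  have := abs_norm_sub_norm_le q p
  rw [norm_sub_rev] at this
  linarith

lemma norm_pow_four_sub_le {x y : ℂ} (hx : ‖x‖ = 1) (hy : ‖y‖ = 1) :
    ‖x ^ 4 - y ^ 4‖ ≤ 4 * ‖x - y‖ := by
  have h : x ^ 4 - y ^ 4 = (x ^ 3 + x ^ 2 * y + x * y ^ 2 + y ^ 3) * (x - y) := by ring
  rw [h, norm_mul]
  gcongr
  calc ‖x ^ 3 + x ^ 2 * y + x * y ^ 2 + y ^ 3‖
      ≤ ‖x ^ 3‖ + ‖x ^ 2 * y‖ + ‖x * y ^ 2‖ + ‖y ^ 3‖ := norm_add₄_le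
    _ = 4 := by simp [hx, hy]; norm_num

lemma rpow_neg_sub_le {γ x y : ℝ} (hγ : γ < 1) (hx : 0 < x) (hxy : x ≤ y) :
    x ^ (-(2 : ℝ) * γ) - y ^ (-(2 : ℝ) * γ) ≤ 2 * (y - x) * x ^ (-(2 : ℝ) * γ - 1) := by
  have hy : 0 < y := hx.trans_le hxy
  have ht : 0 < x / y := by positivity
  have ht1 : x / y ≤ 1 := (div_le_one hy).2 hxy
  have h1 : (x / y) ^ (2 : ℝ) ≤ (x / y) ^ (2 * γ) :=
    Real.rpow_le_rpow_of_exponent_ge ht ht1 (by linarith)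
  have h2 : y ^ (-(2 : ℝ) * γ) = x ^ (-(2 : ℝ) * γ) * (x / y) ^ (2 * γ) := by
    rw [Real.div_rpow hx.le hy.le, neg_mul, Real.rpow_neg hx.le, Real.rpow_neg hy.le]
    have := (Real.rpow_pos_of_pos hx (2 * γ)).ne'
    have := (Real.rpow_pos_of_pos hy (2 * γ)).ne'
    field_simp
  rw [h2, Real.rpow_sub_one hx.ne']
  rw [Real.rpow_two] at h1
  have hX := Real.rpow_pos_of_pos hx (-(2 : ℝ) * γ)
  have h3 : 1 - x / y ≤ (y - x) / x := by
    have h4 : 1 - x / y = (y - x) / y := by field_simp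
    rw [h4]
    exact div_le_div_of_nonneg_left (by linarith) hx hxy
  calc _ = x ^ (-(2 : ℝ) * γ) * (1 - (x / y) ^ (2 * γ)) := by ring
    _ ≤ x ^ (-(2 : ℝ) * γ) * (2 * ((y - x) / x)) := by
      gcongr
      nlinarith [sq_nonneg (1 - x / y)]
    _ = _ := by ring

lemma abs_rpow_neg_sub_le {γ x y : ℝ} (hγ : γ < 1) (hx : 0 < x) (hy : 0 < y) (hγ0 : 0 < γ)
    (hxy : |x - y| ≤ 4) :
    |x ^ (-(2 : ℝ) * γ) - y ^ (-(2 : ℝ) * γ)| ≤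
      8 * (x ^ (-(2 : ℝ) * γ - 1) + y ^ (-(2 : ℝ) * γ - 1)) := by
  wlog h : x ≤ y generalizing x y
  · rw [abs_sub_comm, add_comm]
    exact this hy hx (by rwa [abs_sub_comm]) (le_of_not_ge h)
  have h1 := rpow_neg_sub_le hγ hx h
  have h2 : y ^ (-(2 : ℝ) * γ) ≤ x ^ (-(2 : ℝ) * γ) :=
    Real.rpow_le_rpow_of_nonpos hx h (by linarith)
  have hX := Real.rpow_pos_of_pos hx (-(2 : ℝ) * γ - 1)
  have hY := Real.rpow_pos_of_pos hy (-(2 : ℝ) * γ - 1)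
  rw [abs_of_nonneg (sub_nonneg.2 h2)]
  have := (abs_le.1 hxy).1
  nlinarith

/-- The fourth angular harmonic `exp (4 i φ)` at a lattice point of argument `φ`. -/
noncomputable def harm (k : Fin 2 → ℤ) : ℂ := (toC k / ‖toC k‖) ^ 4

/-- The part of the weight `|k|^s 1_{0 < |k| ≤ N}` carried by points close to the circle of
radius `N`. -/
noncomputable def bdry (s : ℝ) (N : ℕ) (k : Fin 2 → ℤ) : ℝ :=
  if k ≠ 0 ∧ znorm k ≤ N ∧ (N : ℝ) ^ 2 ≤ znorm k ^ 2 + 8 * N then znorm k ^ s else 0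

lemma bdry_nonneg (s : ℝ) (N : ℕ) (k : Fin 2 → ℤ) : 0 ≤ bdry s N k := by
  unfold bdry
  split_ifs
  · exact Real.rpow_nonneg (znorm_nonneg k) s
  · exact le_rfl

lemma support_bdry_finite (s : ℝ) (N : ℕ) : (Function.support (bdry s N)).Finite := by
  refine (finite_ball N).subset fun k hk => ?_
  by_contra h
  exact hk (by simp only [bdry]; rw [if_neg fun h' => h h'.2.1])

lemma summable_bdry (s : ℝ) (N : ℕ) : Summable (bdry s N) :=
  summable_of_hasFiniteSupport (support_bdry_finite s N)

lemma bdry_eq_of_lt {s : ℝ} {N : ℕ} {k : Fin 2 → ℤ} {r : ℝ} (hk : k ≠ 0) (hkN : znorm k ≤ N)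
    (hr : (N : ℝ) < r) (hkr : |znorm k - r| ≤ 4) : bdry s N k = znorm k ^ s := by
  refine if_pos ⟨hk, hkN, ?_⟩
  have := (abs_le.1 hkr).1
  have := znorm_nonneg k
  nlinarith

lemma unit_div_norm {p : ℂ} (hp : p ≠ 0) : ‖p / ‖p‖‖ = 1 := by
  rw [norm_div, Complex.norm_real, norm_norm, div_self (norm_ne_zero_iff.2 hp)]

lemma mul_harm {z : ℂ} (hz : ‖z‖ = √5) (k : Fin 2 → ℤ) :
    z ^ 4 / 25 * harm k = (z * toC k / ‖z * toC k‖) ^ 4 := by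
  have h : ((√5 : ℝ) : ℂ) ^ 4 = 25 := by
    rw [← Complex.ofReal_pow, show (√5 : ℝ) ^ 4 = (√5 ^ 2) ^ 2 by ring,
      Real.sq_sqrt (by norm_num)]
    norm_num
  rw [harm, norm_mul, hz, Complex.ofReal_mul, div_pow, div_pow, mul_pow, mul_pow, h]
  ring

lemma norm_rotated_harm_sub_le {k : Fin 2 → ℤ} (hk : k ≠ 0) :
    ‖(2 + Complex.I) ^ 4 / 25 * harm k - (2 - Complex.I) ^ 4 / 25 * harm (coincidence k)‖ ≤
      32 / znorm k := by
  have hr := one_le_znorm hk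
  have hz : (2 + Complex.I) ≠ 0 := by
    rw [← norm_ne_zero_iff, norm_two_add_I]; positivity
  have hz' : (2 - Complex.I) ≠ 0 := by
    rw [← norm_ne_zero_iff, norm_two_sub_I]; positivity
  have hp : (2 + Complex.I) * toC k ≠ 0 := mul_ne_zero hz (toC_eq_zero.not.2 hk)
  have hq : (2 - Complex.I) * toC (coincidence k) ≠ 0 :=
    mul_ne_zero hz' (toC_eq_zero.not.2 (coincidence_eq_zero.not.2 hk))
  rw [mul_harm norm_two_add_I, mul_harm norm_two_sub_I]
  refine (norm_pow_four_sub_le (unit_div_norm hp) (unit_div_norm hq)).trans ?_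
  have h1 := norm_div_norm_sub_le hp hq
  have h2 : 2 * ‖(2 + Complex.I) * toC k - (2 - Complex.I) * toC (coincidence k)‖ /
      ‖(2 + Complex.I) * toC k‖ ≤ 2 * 8 / (2 * znorm k) := by
    rw [norm_mul (2 + Complex.I), norm_two_add_I, norm_toC]
    gcongr
    · exact norm_sub_coincidence_le k
    · exact two_le_sqrt_five
  calc _ ≤ 4 * (2 * 8 / (2 * znorm k)) := by gcongr; exact h1.trans h2
    _ = _ := by field_simp; norm_num

lemma norm_rotated_harm {z : ℂ} (hz : ‖z‖ = √5) {k : Fin 2 → ℤ} (hk : k ≠ 0) :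
    ‖z ^ 4 / 25 * harm k‖ = 1 := by
  have hz0 : z ≠ 0 := by rw [← norm_ne_zero_iff, hz]; positivity
  rw [mul_harm hz, norm_pow, unit_div_norm (mul_ne_zero hz0 (toC_eq_zero.not.2 hk)), one_pow]

lemma norm_rotated_weight_sub_le {γ : ℝ} (hγ0 : 0 < γ) (hγ : γ < 1) (N : ℕ) (k : Fin 2 → ℤ) :
    ‖(2 + Complex.I) ^ 4 / 25 * ((wt (-(2 : ℝ) * γ) N k : ℂ) * harm k) -
      (2 - Complex.I) ^ 4 / 25 *
        ((wt (-(2 : ℝ) * γ) N (coincidence k) : ℂ) * harm (coincidence k))‖ ≤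
    40 * (wt (-(2 : ℝ) * γ - 1) N k + wt (-(2 : ℝ) * γ - 1) N (coincidence k)) +
      (bdry (-(2 : ℝ) * γ) N k + bdry (-(2 : ℝ) * γ) N (coincidence k)) := by
  have hw := wt_nonneg (-(2 : ℝ) * γ - 1) N k
  have hw' := wt_nonneg (-(2 : ℝ) * γ - 1) N (coincidence k)
  have hb := bdry_nonneg (-(2 : ℝ) * γ) N k
  have hb' := bdry_nonneg (-(2 : ℝ) * γ) N (coincidence k)
  have hd := abs_znorm_sub_coincidence_le k
  by_cases hk : k = 0
  · have h0 : ∀ s, wt s N k = 0 := fun s => if_neg fun h => h.1 hk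
    have h0' : ∀ s, wt s N (coincidence k) = 0 :=
      fun s => if_neg fun h => h.1 (coincidence_eq_zero.2 hk)
    simp only [h0, h0', Complex.ofReal_zero, zero_mul, mul_zero, sub_zero, norm_zero]
    positivity
  have hk' : coincidence k ≠ 0 := coincidence_eq_zero.not.2 hk
  have hr : 0 < znorm k := zero_lt_one.trans_le (one_le_znorm hk)
  have hr' : 0 < znorm (coincidence k) := zero_lt_one.trans_le (one_le_znorm hk')
  have hR := Real.rpow_pos_of_pos hr (-(2 : ℝ) * γ)
  have hR' := Real.rpow_pos_of_pos hr' (-(2 : ℝ) * γ)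
  have hE := norm_rotated_harm norm_two_add_I hk
  have hE' := norm_rotated_harm norm_two_sub_I hk'
  have hEE := norm_rotated_harm_sub_le hk
  simp only [mul_left_comm _ ((wt _ _ _ : ℝ) : ℂ)]
  set e := (2 + Complex.I) ^ 4 / 25 * harm k
  set e' := (2 - Complex.I) ^ 4 / 25 * harm (coincidence k)
  by_cases hN : znorm k ≤ N <;> by_cases hN' : znorm (coincidence k) ≤ N
  · have h1 : ∀ s, wt s N k = znorm k ^ s := fun s => if_pos ⟨hk, hN⟩
    have h1' : ∀ s, wt s N (coincidence k) = znorm (coincidence k) ^ s :=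
      fun s => if_pos ⟨hk', hN'⟩
    rw [h1] at hw
    rw [h1'] at hw'
    rw [h1, h1', h1, h1']
    have h2 := abs_rpow_neg_sub_le hγ hr hr' hγ0 hd
    set R := znorm k ^ (-(2 : ℝ) * γ) with hRdef
    set R' := znorm (coincidence k) ^ (-(2 : ℝ) * γ)
    have h3 : (R : ℂ) * e - (R' : ℂ) * e' = (R : ℂ) * (e - e') + ((R - R' : ℝ) : ℂ) * e' := by
      push_cast; ring
    have h4 : R * (32 / znorm k) = 32 * znorm k ^ (-(2 : ℝ) * γ - 1) := by
      rw [Real.rpow_sub_one hr.ne']; ring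
    rw [h3]
    calc _ ≤ R * (32 / znorm k) + |R - R'| := by
          refine (norm_add_le _ _).trans ?_
          rw [norm_mul, norm_mul, hE', mul_one, Complex.norm_real, Complex.norm_real,
            Real.norm_of_nonneg hR.le, Real.norm_eq_abs]
          gcongr
      _ ≤ _ := by rw [h4]; linarith
  · have h0 : wt (-(2 : ℝ) * γ) N (coincidence k) = 0 := if_neg fun h => hN' h.2
    have h1 : wt (-(2 : ℝ) * γ) N k = znorm k ^ (-(2 : ℝ) * γ) := if_pos ⟨hk, hN⟩
    have h2 := bdry_eq_of_lt (s := -(2 : ℝ) * γ) hk hN (not_le.1 hN') hd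
    rw [h0, h1, Complex.ofReal_zero, zero_mul, sub_zero, norm_mul, hE, mul_one,
      Complex.norm_real, Real.norm_of_nonneg hR.le]
    linarith
  · have h0 : wt (-(2 : ℝ) * γ) N k = 0 := if_neg fun h => hN h.2
    have h1 : wt (-(2 : ℝ) * γ) N (coincidence k) = znorm (coincidence k) ^ (-(2 : ℝ) * γ) :=
      if_pos ⟨hk', hN'⟩
    have h2 := bdry_eq_of_lt (s := -(2 : ℝ) * γ) hk' hN' (not_le.1 hN) (by rwa [abs_sub_comm])
    rw [h0, h1, Complex.ofReal_zero, zero_mul, zero_sub, norm_neg, norm_mul, hE', mul_one,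
      Complex.norm_real, Real.norm_of_nonneg hR'.le]
    linarith
  · have h0 : wt (-(2 : ℝ) * γ) N k = 0 := if_neg fun h => hN h.2
    have h0' : wt (-(2 : ℝ) * γ) N (coincidence k) = 0 := if_neg fun h => hN' h.2
    simp only [h0, h0', Complex.ofReal_zero, zero_mul, sub_zero, norm_zero]
    positivity

lemma tsum_wt_lower {γ : ℝ} (hγ0 : 0 < γ) {N : ℕ} (hN : 1 ≤ N) :
    (N : ℝ) * (N : ℝ) ^ (-(2 : ℝ) * γ) ≤ 4 * ∑' k, wt (-(2 : ℝ) * γ - 1) N k := by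
  have hN0 : (0 : ℝ) < N := by exact_mod_cast hN
  let g : ℕ × ℕ → (Fin 2 → ℤ) := fun p => ![(p.1 : ℤ) + 1, p.2]
  have hg : Function.Injective g := by
    rintro ⟨a, b⟩ ⟨c, d⟩ h
    have h0 := congrFun h 0
    have h1 := congrFun h 1
    simp [g] at h0 h1
    simp [h0, h1]
  let S := Finset.range ((N + 1) / 2) ×ˢ Finset.range (N / 2 + 1)
  have hS : ∀ p ∈ S, (N : ℝ) ^ (-(2 : ℝ) * γ - 1) ≤ wt (-(2 : ℝ) * γ - 1) N (g p) := by
    rintro ⟨a, b⟩ hp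
    simp only [S, Finset.mem_product, Finset.mem_range] at hp
    have h0 : g (a, b) ≠ 0 := fun h => by
      have := congrFun h 0
      simp [g] at this
      omega
    have hab : ((a + 1 + b : ℕ) : ℝ) ≤ N := by
      exact_mod_cast (by omega : a + 1 + b ≤ N)
    have h1 : znorm (g (a, b)) ≤ N := by
      refine le_trans ?_ hab
      apply le_of_sq_le_sq _ (by positivity)
      rw [znorm_sq]
      simp only [g, Matrix.cons_val_zero, Matrix.cons_val_one]
      push_cast
      nlinarith [Nat.cast_nonneg (α := ℝ) a, Nat.cast_nonneg (α := ℝ) b,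
        mul_nonneg (Nat.cast_nonneg (α := ℝ) a) (Nat.cast_nonneg (α := ℝ) b)]
    rw [wt, if_pos ⟨h0, h1⟩]
    exact Real.rpow_le_rpow_of_nonpos (zero_lt_one.trans_le (one_le_znorm h0)) h1 (by linarith)
  have h1 : (N : ℝ) ^ 2 ≤ 4 * S.card := by
    have : N ^ 2 ≤ 4 * S.card := by
      simp only [S, Finset.card_product, Finset.card_range]
      have h3 : N ≤ 2 * ((N + 1) / 2) := by omega
      have h4 : N ≤ 2 * (N / 2 + 1) := by omega
      calc N ^ 2 = N * N := sq N
        _ ≤ (2 * ((N + 1) / 2)) * (2 * (N / 2 + 1)) := Nat.mul_le_mul h3 h4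
        _ = _ := by ring
    exact_mod_cast this
  have h2 : S.card * (N : ℝ) ^ (-(2 : ℝ) * γ - 1) ≤ ∑' k, wt (-(2 : ℝ) * γ - 1) N k := by
    calc S.card * (N : ℝ) ^ (-(2 : ℝ) * γ - 1)
        = ∑ p ∈ S, (N : ℝ) ^ (-(2 : ℝ) * γ - 1) := by simp
      _ ≤ ∑ p ∈ S, wt (-(2 : ℝ) * γ - 1) N (g p) := Finset.sum_le_sum hS
      _ = ∑ k ∈ S.map ⟨g, hg⟩, wt (-(2 : ℝ) * γ - 1) N k := by simp
      _ ≤ _ := (summable_wt _ N).sum_le_tsum _ fun k _ => wt_nonneg _ N k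
  have h3 : (N : ℝ) * (N : ℝ) ^ (-(2 : ℝ) * γ) =
      (N : ℝ) ^ 2 * (N : ℝ) ^ (-(2 : ℝ) * γ - 1) := by
    rw [Real.rpow_sub_one hN0.ne']; field_simp
  rw [h3]
  have := Real.rpow_pos_of_pos hN0 (-(2 : ℝ) * γ - 1)
  nlinarith

/-- Lattice points close to the circle of radius `N`. -/
noncomputable def shell (N : ℕ) : Finset (Fin 2 → ℤ) :=
  (finite_ball N).toFinset.filter fun k => k ≠ 0 ∧ (N : ℝ) ^ 2 ≤ znorm k ^ 2 + 8 * N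

lemma mem_shell {N : ℕ} {k : Fin 2 → ℤ} : k ∈ shell N ↔
    k ≠ 0 ∧ znorm k ≤ N ∧ (N : ℝ) ^ 2 ≤ znorm k ^ 2 + 8 * N := by
  simp [shell]; tauto

lemma le_nine_mul_znorm {N : ℕ} {k : Fin 2 → ℤ} (hk : k ∈ shell N) : (N : ℝ) ≤ 9 * znorm k := by
  obtain ⟨h0, h1, h2⟩ := mem_shell.1 hk
  have h3 := one_le_znorm h0
  by_cases h : (N : ℝ) ≤ 9
  · linarith
  · push Not at h
    by_contra! h4
    nlinarith

lemma shell_int {N : ℕ} {k : Fin 2 → ℤ} (hk : k ∈ shell N) :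
    k 0 ^ 2 + k 1 ^ 2 ≤ (N : ℤ) ^ 2 ∧ (N : ℤ) ^ 2 ≤ k 0 ^ 2 + k 1 ^ 2 + 8 * N ∧
      (N : ℤ) ≤ 9 * (|k 0| + |k 1|) ∧ 0 < |k 0| + |k 1| := by
  obtain ⟨h0, h1, h2⟩ := mem_shell.1 hk
  have h9 := le_nine_mul_znorm hk
  have h3 := one_le_znorm h0
  have h4 : znorm k ^ 2 ≤ (N : ℝ) ^ 2 := pow_le_pow_left₀ (znorm_nonneg k) h1 2
  have h5 : znorm k ≤ |(k 0 : ℝ)| + |(k 1 : ℝ)| := by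
    apply le_of_sq_le_sq _ (by positivity)
    rw [znorm_sq, ← sq_abs (k 0 : ℝ), ← sq_abs (k 1 : ℝ)]
    nlinarith [mul_nonneg (abs_nonneg (k 0 : ℝ)) (abs_nonneg (k 1 : ℝ))]
  rw [znorm_sq] at h2 h4
  have h6 : (N : ℝ) ≤ 9 * (|(k 0 : ℝ)| + |(k 1 : ℝ)|) := by linarith
  have h7 : 0 < |(k 0 : ℝ)| + |(k 1 : ℝ)| := by linarith
  exact ⟨by exact_mod_cast h4, by exact_mod_cast h2, by exact_mod_cast h6, by exact_mod_cast h7⟩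

lemma diagonal_shift_eq {N X Y X' Y' : ℤ} (hX : 0 ≤ X) (hY : 0 ≤ Y)
    (h1 : N ^ 2 ≤ X ^ 2 + Y ^ 2 + 8 * N) (h2 : N ≤ 9 * (X + Y)) (h3 : 0 < X + Y)
    (h4 : X' ^ 2 + Y' ^ 2 ≤ N ^ 2) (hd : X - Y = X' - Y') (hm : X % 37 = X' % 37)
    (hle : X ≤ X') : X = X' := by
  obtain ⟨t, rfl⟩ : ∃ t, X' = X + t := ⟨X' - X, by ring⟩
  obtain rfl : Y' = Y + t := by linarith
  have h5 : t < 37 := by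
    by_contra! h
    nlinarith
  omega

lemma eq_of_abs_eq_of_sign {x y : ℤ} (hs : 0 ≤ x ↔ 0 ≤ y) (h : |x| = |y|) : x = y := by
  rcases abs_eq_abs.1 h with h | h <;> omega

lemma card_shell_le (N : ℕ) : (shell N).card ≤ 148 * (2 * N + 1) := by
  let f : (Fin 2 → ℤ) → Bool × Bool × ℤ × ℤ := fun k =>
    (decide (0 ≤ k 0), decide (0 ≤ k 1), |k 0| - |k 1|, |k 0| % 37)
  let T : Finset (Bool × Bool × ℤ × ℤ) :=
    Finset.univ ×ˢ Finset.univ ×ˢ Finset.Icc (-(N : ℤ)) N ×ˢ Finset.Ico 0 37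
  have hT : T.card = 148 * (2 * N + 1) := by
    simp only [T, Finset.card_product, Int.card_Icc, Int.card_Ico, Finset.card_univ,
      Fintype.card_bool]
    rw [show ((N : ℤ) + 1 - -(N : ℤ)).toNat = 2 * N + 1 by omega]
    simp; ring
  rw [← hT]
  refine Finset.card_le_card_of_injOn f ?_ ?_
  · intro k hk
    obtain ⟨h1, -, -, -⟩ := shell_int hk
    have h0 := abs_le_of_sq_le_sq (show k 0 ^ 2 ≤ (N : ℤ) ^ 2 by nlinarith [sq_nonneg (k 1)])
      (by positivity)
    have h1 := abs_le_of_sq_le_sq (show k 1 ^ 2 ≤ (N : ℤ) ^ 2 by nlinarith [sq_nonneg (k 0)])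
      (by positivity)
    have h2 := abs_nonneg (k 0)
    have h3 := abs_nonneg (k 1)
    simp only [f, T, Finset.coe_product, Set.mem_prod, Finset.mem_coe, Finset.mem_univ,
      Finset.mem_Icc, Finset.mem_Ico, true_and]
    omega
  · intro k hk k' hk' h
    obtain ⟨a1, a2, a3, a4⟩ := shell_int hk
    obtain ⟨b1, b2, b3, b4⟩ := shell_int hk'
    simp only [f, Prod.mk.injEq, decide_eq_decide] at h
    obtain ⟨s0, s1, hd, hm⟩ := h
    rw [← sq_abs (k 0), ← sq_abs (k 1)] at a1 a2
    rw [← sq_abs (k' 0), ← sq_abs (k' 1)] at b1 b2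
    have h0 : |k 0| = |k' 0| := by
      rcases le_total |k 0| |k' 0| with hle | hle
      · exact diagonal_shift_eq (abs_nonneg _) (abs_nonneg _) a2 a3 a4 b1 hd hm hle
      · exact (diagonal_shift_eq (abs_nonneg _) (abs_nonneg _) b2 b3 b4 a1 hd.symm hm.symm
          hle).symm
    have h1 : |k 1| = |k' 1| := by linarith
    ext i
    fin_cases i
    · exact eq_of_abs_eq_of_sign s0 h0
    · exact eq_of_abs_eq_of_sign s1 h1

lemma tsum_bdry_le {γ : ℝ} (hγ0 : 0 < γ) (hγ : γ < 1) {N : ℕ} (hN : 1 ≤ N) :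
    ∑' k, bdry (-(2 : ℝ) * γ) N k ≤ 143856 * ∑' k, wt (-(2 : ℝ) * γ - 1) N k := by
  have hN0 : (0 : ℝ) < N := by exact_mod_cast hN
  have hP := Real.rpow_pos_of_pos hN0 (-(2 : ℝ) * γ)
  have h1 : ∀ k ∈ shell N, bdry (-(2 : ℝ) * γ) N k ≤ 81 * (N : ℝ) ^ (-(2 : ℝ) * γ) := by
    intro k hk
    have h2 := le_nine_mul_znorm hk
    rw [bdry, if_pos (mem_shell.1 hk)]
    calc znorm k ^ (-(2 : ℝ) * γ) ≤ ((N : ℝ) / 9) ^ (-(2 : ℝ) * γ) :=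
          Real.rpow_le_rpow_of_nonpos (by positivity) (by linarith) (by linarith)
      _ = 9 ^ (2 * γ) * (N : ℝ) ^ (-(2 : ℝ) * γ) := by
          rw [Real.div_rpow hN0.le (by norm_num), neg_mul, Real.rpow_neg (by norm_num : (0:ℝ) ≤ 9),
            div_inv_eq_mul, mul_comm]
      _ ≤ 9 ^ (2 : ℝ) * (N : ℝ) ^ (-(2 : ℝ) * γ) := by
          gcongr
          · norm_num
          · linarith
      _ = _ := by norm_num
  have h2 : ∑' k, bdry (-(2 : ℝ) * γ) N k = ∑ k ∈ shell N, bdry (-(2 : ℝ) * γ) N k :=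
    tsum_eq_sum fun k hk => if_neg (mem_shell.not.1 hk)
  have h3 : ((shell N).card : ℝ) ≤ 148 * (2 * N + 1) := by exact_mod_cast card_shell_le N
  have h4 : (1 : ℝ) ≤ N := by exact_mod_cast hN
  have h5 := tsum_wt_lower hγ0 hN
  rw [h2]
  calc _ ≤ (shell N).card • (81 * (N : ℝ) ^ (-(2 : ℝ) * γ)) := Finset.sum_le_card_nsmul _ _ _ h1
    _ ≤ (148 * (3 * N)) * (81 * (N : ℝ) ^ (-(2 : ℝ) * γ)) := by
        rw [nsmul_eq_mul]
        gcongr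
        linarith
    _ ≤ _ := by linarith

/-- The fourth angular harmonic averages to zero up to a lower-order error. -/
lemma norm_tsum_harm_le {γ : ℝ} (hγ0 : 0 < γ) (hγ : γ < 1) {N : ℕ} (hN : 1 ≤ N) :
    ‖∑' k, (wt (-(2 : ℝ) * γ) N k : ℂ) * harm k‖ ≤
      300000 * ∑' k, wt (-(2 : ℝ) * γ - 1) N k := by
  set V := ∑' k, wt (-(2 : ℝ) * γ - 1) N k
  set u : (Fin 2 → ℤ) → ℂ := fun k => (wt (-(2 : ℝ) * γ) N k : ℂ) * harm k
  have hu : Summable u := summable_wt_mul_complex _ N _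
  have hu' : Summable fun k => u (coincidence k) := coincidence.summable_iff.2 hu
  have hw := summable_wt (-(2 : ℝ) * γ - 1) N
  have hw' := coincidence.summable_iff.2 hw
  have hb := summable_bdry (-(2 : ℝ) * γ) N
  have hb' := coincidence.summable_iff.2 hb
  have h1 : ∑' k, ((2 + Complex.I) ^ 4 / 25 * u k -
      (2 - Complex.I) ^ 4 / 25 * u (coincidence k)) = (48 / 25 * Complex.I) * ∑' k, u k := by
    rw [(hu.mul_left _).tsum_sub (hu'.mul_left _), tsum_mul_left, tsum_mul_left,
      coincidence.tsum_eq u, ← sub_mul]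
    congr 1
    have h2 : (2 + Complex.I) ^ 4 - (2 - Complex.I) ^ 4 =
        64 * Complex.I + 16 * Complex.I * Complex.I ^ 2 := by ring
    rw [← sub_div, h2, Complex.I_sq]
    ring
  have hsum := ((hw.add hw').mul_left 40).add (hb.add hb')
  have h2 := tsum_of_norm_bounded hsum.hasSum (norm_rotated_weight_sub_le hγ0 hγ N)
  have h3 : ∑' k, (40 * (wt (-(2 : ℝ) * γ - 1) N k + (wt (-(2 : ℝ) * γ - 1) N ∘ coincidence) k) +
      (bdry (-(2 : ℝ) * γ) N k + (bdry (-(2 : ℝ) * γ) N ∘ coincidence) k)) =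
      40 * (V + V) + (∑' k, bdry (-(2 : ℝ) * γ) N k + ∑' k, bdry (-(2 : ℝ) * γ) N k) := by
    rw [((hw.add hw').mul_left 40).tsum_add (hb.add hb'), tsum_mul_left, hw.tsum_add hw',
      hb.tsum_add hb']
    simp only [Function.comp_apply]
    rw [coincidence.tsum_eq (wt (-(2 : ℝ) * γ - 1) N), coincidence.tsum_eq (bdry (-(2 : ℝ) * γ) N)]
  rw [h3, h1, norm_mul] at h2
  have h4 : ‖(48 / 25 * Complex.I : ℂ)‖ = 48 / 25 := by simp
  rw [h4] at h2
  have h5 := tsum_bdry_le hγ0 hγ hN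
  have h6 : 0 ≤ V := tsum_nonneg (wt_nonneg _ N)
  linarith [norm_nonneg (∑' k, u k)]

lemma rdot_two (a : Fin 2 → ℝ) (k : Fin 2 → ℤ) : rdot a k = a 0 * k 0 + a 1 * k 1 := by
  simp [rdot]

lemma rdot_sub_of_orthogonal {a : Fin 2 → ℝ} {l : Fin 2 → ℤ} (h : rdot a l = 0)
    (k : Fin 2 → ℤ) : rdot a (k - l) = rdot a k := by
  rw [rdot_two] at *
  rw [rdot_two]
  simp only [Pi.sub_apply, Int.cast_sub]
  linear_combination -h

lemma abs_rdot_le {a : Fin 2 → ℝ} (ha : ∑ i, a i ^ 2 = 1) (k : Fin 2 → ℤ) :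
    |rdot a k| ≤ znorm k := by
  refine abs_le_of_sq_le_sq ?_ (znorm_nonneg k)
  rw [znorm_sq, rdot_two]
  rw [Fin.sum_univ_two] at ha
  have h : (a 0 * k 0 + a 1 * k 1) ^ 2 + (a 0 * k 1 - a 1 * k 0) ^ 2 =
      (k 0 : ℝ) ^ 2 + (k 1 : ℝ) ^ 2 := by
    linear_combination ((k 0 : ℝ) ^ 2 + (k 1 : ℝ) ^ 2) * ha
  nlinarith [sq_nonneg (a 0 * k 1 - a 1 * k 0)]

lemma sin2_eq_of_orthogonal {a : Fin 2 → ℝ} (ha : ∑ i, a i ^ 2 = 1) {k l : Fin 2 → ℤ}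
    (hal : rdot a l = 0) (hk : k ≠ 0) (hl : l ≠ 0) :
    sin2 k l = rdot a k ^ 2 / znorm k ^ 2 := by
  have hr := zero_lt_one.trans_le (one_le_znorm hk)
  have hL := zero_lt_one.trans_le (one_le_znorm hl)
  have h : zdot k l ^ 2 + rdot a k ^ 2 * znorm l ^ 2 = znorm k ^ 2 * znorm l ^ 2 := by
    rw [znorm_sq, znorm_sq, rdot_two, zdot, Fin.sum_univ_two]
    rw [Fin.sum_univ_two] at ha
    rw [rdot_two] at hal
    obtain ⟨t, ht⟩ : ∃ t, t = a 1 * (l 0 : ℝ) - a 0 * l 1 := ⟨_, rfl⟩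
    have h0 : (l 0 : ℝ) = a 1 * t := by
      rw [ht]; linear_combination (-(l 0 : ℝ)) * ha + a 0 * hal
    have h1 : (l 1 : ℝ) = -a 0 * t := by
      rw [ht]; linear_combination (-(l 1 : ℝ)) * ha + a 1 * hal
    rw [h0, h1]
    linear_combination t ^ 2 * (a 0 * k 0 + a 1 * k 1) ^ 2 * ha
  rw [sin2]
  field_simp
  linarith

lemma abs_znorm_sub_znorm_sub_le (k l : Fin 2 → ℤ) : |znorm k - znorm (k - l)| ≤ znorm l := by
  have h : toC k - toC (k - l) = toC l := by apply Complex.ext <;> simp [toC]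
  rw [← norm_toC, ← norm_toC, ← norm_toC, ← h]
  exact abs_norm_sub_norm_le _ _

/-- Replacing `k - l` by `k` in the angular factor costs at most `2 |l| / |k|`. -/
lemma abs_angular_sub_le {a : Fin 2 → ℝ} (ha : ∑ i, a i ^ 2 = 1) {k l : Fin 2 → ℤ}
    (hal : rdot a l = 0) (hk : k ≠ 0) (hl : l ≠ 0) :
    |(if k ≠ l then sin2 k l * (rdot a (k - l) ^ 2 / znorm (k - l) ^ 2) else 0) -
      rdot a k ^ 4 / znorm k ^ 4| ≤ 2 * znorm l / znorm k := by
  have hr := zero_lt_one.trans_le (one_le_znorm hk)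
  have hL := zero_lt_one.trans_le (one_le_znorm hl)
  by_cases hkl : k = l
  · subst hkl
    simp only [ne_eq, not_true_eq_false, if_false, hal]
    simp
    positivity
  have hd := zero_lt_one.trans_le (one_le_znorm (sub_ne_zero.2 hkl))
  have hs := abs_rdot_le ha k
  have hs' := abs_rdot_le ha (k - l)
  rw [rdot_sub_of_orthogonal hal] at hs'
  rw [if_pos hkl, sin2_eq_of_orthogonal ha hal hk hl, rdot_sub_of_orthogonal hal]
  have ht := abs_znorm_sub_znorm_sub_le k l
  set s := rdot a k
  set r := znorm k
  set d := znorm (k - l)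
  set L := znorm l
  have h1 : s ^ 2 / r ^ 2 * (s ^ 2 / d ^ 2) - s ^ 4 / r ^ 4 =
      s ^ 4 * ((r + d) * (r - d)) / (r ^ 4 * d ^ 2) := by
    field_simp
    ring
  have hp : |s| ^ 2 ≤ r * d := by
    rw [sq]; exact mul_le_mul hs hs' (abs_nonneg s) hr.le
  have h2 : |s| ^ 4 * r ≤ r ^ 3 * d ^ 2 := by
    calc |s| ^ 4 * r = (|s| ^ 2) ^ 2 * r := by ring
      _ ≤ (r * d) ^ 2 * r := by gcongr
      _ = _ := by ring
  have h3 : |s| ^ 4 * d ≤ r ^ 3 * d ^ 2 := by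
    calc |s| ^ 4 * d = (|s| ^ 2) * |s| ^ 2 * d := by ring
      _ ≤ (r * d) * r ^ 2 * d := by gcongr
      _ = _ := by ring
  rw [h1, abs_div, abs_mul, abs_mul, abs_pow, abs_of_pos (add_pos hr hd),
    abs_of_pos (by positivity : 0 < r ^ 4 * d ^ 2), div_le_div_iff₀ (by positivity) hr]
  calc |s| ^ 4 * ((r + d) * |r - d|) * r = (|s| ^ 4 * r + |s| ^ 4 * d) * |r - d| * r := by ring
    _ ≤ (r ^ 3 * d ^ 2 + r ^ 3 * d ^ 2) * L * r := by gcongr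
    _ = _ := by ring

lemma angular_eq_harmonics {a : Fin 2 → ℝ} (ha : ∑ i, a i ^ 2 = 1) {k : Fin 2 → ℤ}
    (hk : k ≠ 0) :
    rdot a k ^ 4 / znorm k ^ 4 = 3 / 8 +
      ((a 0 - a 1 * Complex.I) ^ 2 * toC k ^ 2).re / (2 * znorm k ^ 2) +
      ((a 0 - a 1 * Complex.I) ^ 4 * harm k).re / 8 := by
  have hr := zero_lt_one.trans_le (one_le_znorm hk)
  obtain ⟨t, ht⟩ : ∃ t : ℝ, t = a 0 * k 1 - a 1 * k 0 := ⟨_, rfl⟩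
  have hw : (a 0 - a 1 * Complex.I) * toC k = (rdot a k : ℂ) + t * Complex.I := by
    rw [rdot_two, ht]
    apply Complex.ext
    · simp [toC]
    · simp [toC]; ring
  have hn : znorm k ^ 2 = rdot a k ^ 2 + t ^ 2 := by
    rw [znorm_sq, rdot_two, ht]
    rw [Fin.sum_univ_two] at ha
    linear_combination (-((k 0 : ℝ) ^ 2 + (k 1 : ℝ) ^ 2)) * ha
  have h4 : (a 0 - a 1 * Complex.I) ^ 4 * harm k =
      ((rdot a k : ℂ) + t * Complex.I) ^ 4 / ((znorm k ^ 4 : ℝ) : ℂ) := by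
    rw [harm, div_pow, norm_toC, ← hw]; push_cast; ring
  rw [← mul_pow, hw, h4, Complex.div_ofReal_re]
  set s := rdot a k
  have e2 : (((s : ℂ) + t * Complex.I) ^ 2).re = s ^ 2 - t ^ 2 := by
    simp [pow_succ]
  have e4 : (((s : ℂ) + t * Complex.I) ^ 4).re = s ^ 4 - 6 * s ^ 2 * t ^ 2 + t ^ 4 := by
    simp [pow_succ]; ring
  rw [e2, e4]
  have hn4 : znorm k ^ 4 = (s ^ 2 + t ^ 2) ^ 2 := by rw [← hn]; ring
  have hpos : 0 < s ^ 2 + t ^ 2 := by rw [← hn]; positivity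
  rw [hn4, hn]
  field_simp
  ring

lemma norm_sub_mul_I {a : Fin 2 → ℝ} (ha : ∑ i, a i ^ 2 = 1) :
    ‖(a 0 - a 1 * Complex.I : ℂ)‖ = 1 := by
  rw [← sq_eq_sq₀ (norm_nonneg _) zero_le_one, Complex.sq_norm, Complex.normSq_apply]
  rw [Fin.sum_univ_two] at ha
  simp
  linarith

/-- The weighted mean of `(a·k)⁴ / |k|⁴` is `3/8` up to a lower-order error. -/
lemma abs_tsum_angular_sub_le {γ : ℝ} (hγ0 : 0 < γ) (hγ : γ < 1) {N : ℕ} (hN : 1 ≤ N)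
    {a : Fin 2 → ℝ} (ha : ∑ i, a i ^ 2 = 1) :
    |∑' k, wt (-(2 : ℝ) * γ) N k * (rdot a k ^ 4 / znorm k ^ 4) -
        3 / 8 * ∑' k, wt (-(2 : ℝ) * γ) N k| ≤
      37500 * ∑' k, wt (-(2 : ℝ) * γ - 1) N k := by
  set c : ℂ := a 0 - a 1 * Complex.I with hc
  have hW := norm_tsum_harm_le hγ0 hγ hN
  have hS := summable_wt_mul_complex (-(2 : ℝ) * γ) N harm
  have h1 : ∀ k, wt (-(2 : ℝ) * γ) N k * (rdot a k ^ 4 / znorm k ^ 4) =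
      3 / 8 * wt (-(2 : ℝ) * γ) N k +
        wt (-(2 : ℝ) * γ) N k * ((c ^ 2 * toC k ^ 2).re / (2 * znorm k ^ 2)) +
        wt (-(2 : ℝ) * γ) N k * ((c ^ 4 * harm k).re / 8) := by
    intro k
    by_cases hk : k = 0
    · have h0 : wt (-(2 : ℝ) * γ) N k = 0 := if_neg fun h => h.1 hk
      simp only [h0, zero_mul, mul_zero, add_zero]
    · rw [angular_eq_harmonics ha hk]; ring
  have h2 : ∑' k, wt (-(2 : ℝ) * γ) N k * ((c ^ 4 * harm k).re / 8) =
      (c ^ 4 * ∑' k, (wt (-(2 : ℝ) * γ) N k : ℂ) * harm k).re / 8 := by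
    rw [← tsum_mul_left, Complex.re_tsum (hS.mul_left _), ← tsum_div_const]
    refine tsum_congr fun k => ?_
    rw [mul_left_comm, Complex.re_ofReal_mul, mul_div_assoc]
  rw [tsum_congr h1, (((summable_wt _ N).mul_left _).add
    (summable_wt_mul _ N _)).tsum_add (summable_wt_mul _ N _),
    ((summable_wt _ N).mul_left _).tsum_add (summable_wt_mul _ N _), tsum_second_harmonic,
    tsum_mul_left, h2]
  have h3 := Complex.abs_re_le_norm (c ^ 4 * ∑' k, (wt (-(2 : ℝ) * γ) N k : ℂ) * harm k)
  rw [norm_mul, norm_pow, norm_sub_mul_I ha, one_pow, one_mul] at h3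
  rw [add_zero, add_sub_cancel_left, abs_div, abs_of_pos (by norm_num : (0 : ℝ) < 8)]
  linarith

lemma abs_tsum_weighted_angular_sub_le {γ : ℝ} {N : ℕ} {a : Fin 2 → ℝ}
    (ha : ∑ i, a i ^ 2 = 1) {l : Fin 2 → ℤ} (hal : rdot a l = 0) (hl : l ≠ 0) :
    |∑' k, wt (-(2 : ℝ) * γ) N k *
          (if k ≠ l then sin2 k l * (rdot a (k - l) ^ 2 / znorm (k - l) ^ 2) else 0) -
        ∑' k, wt (-(2 : ℝ) * γ) N k * (rdot a k ^ 4 / znorm k ^ 4)| ≤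
      2 * znorm l * ∑' k, wt (-(2 : ℝ) * γ - 1) N k := by
  rw [← (summable_wt_mul _ N _).tsum_sub (summable_wt_mul _ N _), ← tsum_mul_left,
    ← Real.norm_eq_abs]
  refine tsum_of_norm_bounded ((summable_wt _ N).mul_left _).hasSum fun k => ?_
  rw [← mul_sub, norm_mul, Real.norm_eq_abs, Real.norm_eq_abs, abs_of_nonneg (wt_nonneg _ N k)]
  by_cases h : k ≠ 0 ∧ znorm k ≤ N
  · have hr := zero_lt_one.trans_le (one_le_znorm h.1)
    have hw : wt (-(2 : ℝ) * γ - 1) N k = wt (-(2 : ℝ) * γ) N k / znorm k := by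
      rw [wt, wt, if_pos h, if_pos h, Real.rpow_sub_one hr.ne']
    calc _ ≤ wt (-(2 : ℝ) * γ) N k * (2 * znorm l / znorm k) :=
          mul_le_mul_of_nonneg_left (abs_angular_sub_le ha hal h.1 hl) (wt_nonneg _ N k)
      _ = _ := by rw [hw]; ring
  · have h0 : ∀ s, wt s N k = 0 := fun s => if_neg h
    simp [h0]

lemma thetaN_sq {γ : ℝ} (N : ℕ) (k : Fin 2 → ℤ) :
    thetaN 2 γ N k ^ 2 = epsN 2 γ N * wt (-(2 : ℝ) * γ) N k := by
  have he : 0 ≤ epsN 2 γ N := inv_nonneg.2 (tsum_nonneg (wt_nonneg (-(2 : ℝ) * γ) N))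
  simp only [thetaN, wt, one_le_znorm_iff]
  split_ifs with h
  · rw [mul_pow, Real.sq_sqrt he, ← Real.rpow_mul_natCast (znorm_nonneg k)]
    congr 2
    push_cast; ring
  · simp

/-- 2D:
`|∑_{k ≠ 0, k ≠ l} (θ^N_k)² sin²(∠_{k,l}) (a·(k-l))²/|k-l|² - 3/8| ≤ C D_N |l|`
uniformly in `N ≥ 1`, `l ∈ ℤ²₀` and unit vectors `a ⟂ l`. -/
theorem stmt17 (γ : ℝ) (hγ : 0 < γ ∧ γ < 1) :
    ∃ C : ℝ, 0 < C ∧ ∀ N : ℕ, 1 ≤ N → ∀ l : Fin 2 → ℤ, l ≠ 0 →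
      ∀ a : Fin 2 → ℝ, (∑ i, a i ^ 2 = 1) → rdot a l = 0 →
        |(∑' k : Fin 2 → ℤ,
            if k ≠ 0 ∧ k ≠ l then
              thetaN 2 γ N k ^ 2 * sin2 k l *
                (rdot a (k - l) ^ 2 / znorm (k - l) ^ 2)
            else 0) - 3 / 8| ≤ C * DN 2 γ N * znorm l := by
  refine ⟨37502, by norm_num, fun N hN l hl a ha hal => ?_⟩
  have h1 : ∀ k : Fin 2 → ℤ, (if k ≠ 0 ∧ k ≠ l then
      thetaN 2 γ N k ^ 2 * sin2 k l * (rdot a (k - l) ^ 2 / znorm (k - l) ^ 2) else 0) =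
      epsN 2 γ N * (wt (-(2 : ℝ) * γ) N k *
        (if k ≠ l then sin2 k l * (rdot a (k - l) ^ 2 / znorm (k - l) ^ 2) else 0)) := by
    intro k
    by_cases hk : k = 0
    · have h0 : wt (-(2 : ℝ) * γ) N k = 0 := if_neg fun h => h.1 hk
      simp only [hk, ne_eq, not_true_eq_false, false_and, if_false]
      rw [← hk, h0, zero_mul, mul_zero]
    · by_cases hkl : k = l
      · simp [hkl]
      · rw [if_pos ⟨hk, hkl⟩, if_pos hkl, thetaN_sq]; ring
  have hS := tsum_wt_pos (s := -(2 : ℝ) * γ) hN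
  have he : epsN 2 γ N = (∑' k, wt (-(2 : ℝ) * γ) N k)⁻¹ := rfl
  have hD : DN 2 γ N = epsN 2 γ N * ∑' k, wt (-(2 : ℝ) * γ - 1) N k := rfl
  have hepos : 0 < epsN 2 γ N := by rw [he]; positivity
  have hV : 0 ≤ ∑' k, wt (-(2 : ℝ) * γ - 1) N k := tsum_nonneg (wt_nonneg _ N)
  have h2 := abs_tsum_angular_sub_le hγ.1 hγ.2 hN ha
  have h3 := abs_tsum_weighted_angular_sub_le (γ := γ) (N := N) ha hal hl
  have hL := one_le_znorm hl
  have he1 : epsN 2 γ N * ∑' k, wt (-(2 : ℝ) * γ) N k = 1 := by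
    rw [he]; exact inv_mul_cancel₀ hS.ne'
  rw [tsum_congr h1, tsum_mul_left, hD]
  set Q := ∑' k, wt (-(2 : ℝ) * γ) N k *
    (if k ≠ l then sin2 k l * (rdot a (k - l) ^ 2 / znorm (k - l) ^ 2) else 0)
  set P := ∑' k, wt (-(2 : ℝ) * γ) N k * (rdot a k ^ 4 / znorm k ^ 4)
  set S := ∑' k, wt (-(2 : ℝ) * γ) N k
  set V := ∑' k, wt (-(2 : ℝ) * γ - 1) N k
  have h4 : epsN 2 γ N * Q - 3 / 8 = epsN 2 γ N * ((Q - P) + (P - 3 / 8 * S)) := by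
    linear_combination (3 / 8 : ℝ) * he1
  rw [h4, abs_mul, abs_of_pos hepos]
  have h5 : |Q - P + (P - 3 / 8 * S)| ≤ 37502 * V * znorm l := by
    refine (abs_add_le _ _).trans ?_
    nlinarith [mul_le_mul_of_nonneg_left hL hV]
  calc _ ≤ epsN 2 γ N * (37502 * V * znorm l) := by gcongr
    _ = _ := by ring
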